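/- arXiv:2008.08934 — 3 statements merged into one kernel-verified Lean document; each statement's English description precedes it below -/
import Mathlib

section
/- Let p : L¹ → [0,∞] be sublinear, symmetric, satisfy (A1), and be sequentially lower semicontinuous with respect to ‖·‖₁-convergence (if u^ν → u in L¹ then p(u) ≤ liminf p(u^ν)). Then U := {u ∈ L¹ : p(u) < ∞}, equipped with the norm p, is complete: every sequence (u^ν) in U with p(u^ν − u^μ) → 0 as ν,μ → ∞ admits a limit u ∈ U with p(u^ν − u) → 0. -/
open MeasureTheory Filter Topology ENNReal

/-- Let `p : L¹ → [0,∞]` be sublinear, symmetric, satisfy (A1), and be sequentially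
lower semicontinuous with respect to `‖·‖₁`-convergence.  Then
`U := {u ∈ L¹ : p(u) < ∞}`, equipped with the norm `p`, is complete: every sequence
`(uⁿ)` in `U` with `p(uⁿ − uᵐ) → 0` as `n,m → ∞` admits a limit `u ∈ U` with
`p(uⁿ − u) → 0`. -/
theorem complete_of_lsc
    {Ω : Type*} [MeasurableSpace Ω] (P : Measure Ω) [IsProbabilityMeasure P]
    (p : Lp ℝ 1 P → ℝ≥0∞)
    (hsub : ∀ u v : Lp ℝ 1 P, p (u + v) ≤ p u + p v)
    (hpos : ∀ (c : ℝ), 0 ≤ c → ∀ u : Lp ℝ 1 P, p (c • u) = ENNReal.ofReal c * p u)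
    (hsym : ∀ u : Lp ℝ 1 P, p (-u) = p u)
    (hA1 : ∃ c : ℝ, 0 < c ∧ ∀ u : Lp ℝ 1 P, ENNReal.ofReal (c * ‖u‖) ≤ p u)
    (hlsc : ∀ (u : Lp ℝ 1 P) (v : ℕ → Lp ℝ 1 P), Tendsto v atTop (𝓝 u) →
      p u ≤ Filter.liminf (fun n => p (v n)) atTop) :
    ∀ u : ℕ → Lp ℝ 1 P, (∀ n, p (u n) < ⊤) →
      Tendsto (fun nm : ℕ × ℕ => p (u nm.1 - u nm.2)) atTop (𝓝 0) →
      ∃ ulim : Lp ℝ 1 P, p ulim < ⊤ ∧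
        Tendsto (fun n => p (u n - ulim)) atTop (𝓝 0) := by
  intro u hu hcauchy
  have hunif : ∀ ε : ℝ≥0∞, 0 < ε → ∃ N, ∀ n ≥ N, ∀ m ≥ N, p (u n - u m) ≤ ε := by
    intro ε hε
    obtain ⟨⟨a, b⟩, hN⟩ := ENNReal.tendsto_atTop_zero.1 hcauchy ε hε
    exact ⟨max a b, fun n hn m hm =>
      hN (n, m) ⟨(le_max_left a b).trans hn, (le_max_right a b).trans hm⟩⟩
  obtain ⟨c, hc, hnorm⟩ := hA1
  have hL1 : CauchySeq u := by
    refine Metric.cauchySeq_iff.2 fun ε hε => ?_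
    obtain ⟨N, hN⟩ := hunif (ENNReal.ofReal (c * (ε / 2))) (by simpa using by positivity)
    refine ⟨N, fun n hn m hm => ?_⟩
    have h := (ENNReal.ofReal_le_ofReal_iff (by positivity)).1 ((hnorm _).trans (hN n hn m hm))
    rw [dist_eq_norm]
    linarith [le_of_mul_le_mul_left h hc]
  obtain ⟨w, hw⟩ := cauchySeq_tendsto_of_complete hL1
  have hlim : ∀ ε : ℝ≥0∞, 0 < ε → ∃ N, ∀ n ≥ N, p (u n - w) ≤ ε := by
    intro ε hε
    obtain ⟨N, hN⟩ := hunif ε hε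
    refine ⟨N, fun n hn => (hlsc _ _ (tendsto_const_nhds.sub hw)).trans ?_⟩
    exact Filter.liminf_le_of_frequently_le'
      ((eventually_ge_atTop N).mono fun m hm => hN n hn m hm).frequently
  refine ⟨w, ?_, ENNReal.tendsto_atTop_zero.2 hlim⟩
  obtain ⟨N, hN⟩ := hlim 1 one_pos
  calc p w = p (u N + -(u N - w)) := by congr 1; abel
    _ ≤ p (u N) + p (u N - w) := (hsub _ _).trans_eq (by rw [hsym])
    _ < ⊤ := ENNReal.add_lt_top.2 ⟨hu N, (hN N le_rfl).trans_lt one_lt_top⟩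
end

section
/- Let p : L¹ → [0,∞] be sublinear and symmetric and satisfy (A3). Then p is sequentially lower semicontinuous with respect to ‖·‖₁-convergence if and only if p has the Fatou property: for every η ∈ L¹ and every sequence (η^ν) ⊆ L¹ with 0 ≤ η^ν and η^ν increasing pointwise a.s. to η, one has p(η^ν) → p(η). -/
open MeasureTheory Filter Topology ENNReal

theorem tendsto_iInf_nat_add {a : ℕ → ℝ} {L : ℝ} (hbdd : BddBelow (Set.range a))
    (ha : Tendsto a atTop (𝓝 L)) : Tendsto (fun k => ⨅ j, a (k + j)) atTop (𝓝 L) := by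
  have hbdd' (k : ℕ) : BddBelow (Set.range fun j => a (k + j)) :=
    hbdd.mono (Set.range_comp_subset_range (fun j => k + j) a)
  refine tendsto_order.2 ⟨fun b hb => ?_, fun b hb => ?_⟩
  · obtain ⟨c, hbc, hcL⟩ := exists_between hb
    obtain ⟨N, hN⟩ := eventually_atTop.1 (ha.eventually_const_lt hcL)
    filter_upwards [eventually_ge_atTop N] with k hk
    exact hbc.trans_le (le_ciInf fun j => (hN (k + j) (by lia)).le)
  · filter_upwards [ha.eventually_lt_const hb] with k hk
    exact (ciInf_le (hbdd' k) 0).trans_lt hk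

theorem monotone_iInf_nat_add {a : ℕ → ℝ} (hbdd : BddBelow (Set.range a)) :
    Monotone fun k => ⨅ j, a (k + j) := by
  intro k l hkl
  refine le_ciInf fun j => ?_
  have h := ciInf_le (hbdd.mono (Set.range_comp_subset_range (fun j => k + j) a)) (l - k + j)
  have hidx : k + (l - k + j) = l + j := by lia
  simpa [Function.comp_def, hidx] using h

theorem tendsto_Lp_one_of_ae_tendsto_of_dominated {Ω : Type*} [MeasurableSpace Ω] {P : Measure Ω}
    {η g : Lp ℝ 1 P} {f : ℕ → Lp ℝ 1 P} (hbound : ∀ n, ∀ᵐ ω ∂P, |f n ω| ≤ g ω)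
    (hlim : ∀ᵐ ω ∂P, Tendsto (fun n => f n ω) atTop (𝓝 (η ω))) :
    Tendsto f atTop (𝓝 η) := by
  rw [Lp.tendsto_Lp_iff_tendsto_eLpNorm']
  simp_rw [eLpNorm_one_eq_lintegral_enorm]
  have h := tendsto_lintegral_norm_of_dominated_convergence
    (fun n => (Lp.memLp (f n)).1) (L1.integrable_coeFn g).2 hbound hlim
  simpa only [Pi.sub_apply, ofReal_norm] using h

/-- An almost everywhere convergent sequence in `L¹` yields an increasing sequence of nonnegative
minorants of its absolute values, converging almost everywhere to the absolute value of the
limit. -/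
theorem exists_monotone_minorant_of_ae_tendsto {Ω : Type*} [MeasurableSpace Ω] {P : Measure Ω}
    {u : Lp ℝ 1 P} {v : ℕ → Lp ℝ 1 P}
    (hv : ∀ᵐ ω ∂P, Tendsto (fun n => v n ω) atTop (𝓝 (u ω))) :
    ∃ w : ℕ → Lp ℝ 1 P, (∀ n, ∀ᵐ ω ∂P, |w n ω| ≤ |v n ω|) ∧
      ∀ᵐ ω ∂P, (∀ n, 0 ≤ w n ω) ∧ Monotone (fun n => w n ω) ∧
        Tendsto (fun n => w n ω) atTop (𝓝 (|u| ω)) := by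
  let a (ω : Ω) (n : ℕ) : ℝ := |v n ω| ⊓ |u ω|
  let W (k : ℕ) (ω : Ω) : ℝ := ⨅ j, a ω (k + j)
  have ha (ω : Ω) (n : ℕ) : 0 ≤ a ω n := le_inf (abs_nonneg _) (abs_nonneg _)
  have hbdd (ω : Ω) : BddBelow (Set.range (a ω)) := ⟨0, Set.forall_mem_range.2 (ha ω)⟩
  have hW_nonneg (k : ℕ) (ω : Ω) : 0 ≤ W k ω := le_ciInf fun j => ha ω (k + j)
  have hW_le (k : ℕ) (ω : Ω) : W k ω ≤ a ω k :=
    ciInf_le ((hbdd ω).mono (Set.range_comp_subset_range (fun j => k + j) (a ω))) 0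
  have hW_meas (k : ℕ) : Measurable (W k) := by
    refine Measurable.iInf fun j => ?_
    exact ((Lp.stronglyMeasurable (v (k + j))).measurable.norm).inf
      (Lp.stronglyMeasurable u).measurable.norm
  have hW_mem (k : ℕ) : MemLp (W k) 1 P := by
    refine (Lp.memLp u).of_le (hW_meas k).aestronglyMeasurable (ae_of_all _ fun ω => ?_)
    rw [Real.norm_of_nonneg (hW_nonneg k ω)]
    exact (hW_le k ω).trans inf_le_right
  refine ⟨fun k => (hW_mem k).toLp, fun n => ?_, ?_⟩
  · filter_upwards [(hW_mem n).coeFn_toLp] with ω hω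
    rw [hω, abs_of_nonneg (hW_nonneg n ω)]
    exact (hW_le n ω).trans inf_le_left
  · filter_upwards [ae_all_iff.2 fun k => (hW_mem k).coeFn_toLp, hv, Lp.coeFn_abs u]
      with ω hω hvω huω
    simp only [hω, huω]
    refine ⟨fun n => hW_nonneg n ω, monotone_iInf_nat_add (hbdd ω),
      tendsto_iInf_nat_add (hbdd ω) ?_⟩
    simpa using hvω.abs.inf_nhds (tendsto_const_nhds (x := |u ω|))

/-- Let `p : L¹ → [0,∞]` be sublinear and symmetric and satisfy (A3).  Then `p` is
sequentially lower semicontinuous with respect to `‖·‖₁`-convergence if and only if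
`p` has the Fatou property: for every `η ∈ L¹` and every sequence `(ηⁿ) ⊆ L¹` with
`0 ≤ ηⁿ` and `ηⁿ` increasing pointwise a.s. to `η`, one has `p(ηⁿ) → p(η)`. -/
theorem lsc_iff_fatou
    {Ω : Type*} [MeasurableSpace Ω] (P : Measure Ω) [IsProbabilityMeasure P]
    (p : Lp ℝ 1 P → ℝ≥0∞)
    (hsub : ∀ u v : Lp ℝ 1 P, p (u + v) ≤ p u + p v)
    (hpos : ∀ (c : ℝ), 0 ≤ c → ∀ u : Lp ℝ 1 P, p (c • u) = ENNReal.ofReal c * p u)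
    (hsym : ∀ u : Lp ℝ 1 P, p (-u) = p u)
    (hA3 : ∀ u' u : Lp ℝ 1 P, (∀ᵐ ω ∂P, |u' ω| ≤ |u ω|) → p u' ≤ p u) :
    (∀ (u : Lp ℝ 1 P) (v : ℕ → Lp ℝ 1 P), Tendsto v atTop (𝓝 u) →
      p u ≤ Filter.liminf (fun n => p (v n)) atTop)
    ↔
    (∀ (η : Lp ℝ 1 P) (η' : ℕ → Lp ℝ 1 P),
      (∀ᵐ ω ∂P, (∀ n, 0 ≤ η' n ω) ∧ Monotone (fun n => η' n ω) ∧
        Tendsto (fun n => η' n ω) atTop (𝓝 (η ω))) →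
      Tendsto (fun n => p (η' n)) atTop (𝓝 (p η))) := by
  constructor
  · intro hlsc η η' hη
    have habs (n : ℕ) : ∀ᵐ ω ∂P, |η' n ω| ≤ |η ω| := by
      filter_upwards [hη] with ω ⟨h0, hmono, hlim⟩
      rw [abs_of_nonneg (h0 n)]
      exact (hmono.ge_of_tendsto hlim n).trans (le_abs_self _)
    have hconv : Tendsto η' atTop (𝓝 η) := by
      refine tendsto_Lp_one_of_ae_tendsto_of_dominated (g := |η|) (fun n => ?_)
        (hη.mono fun ω h => h.2.2)
      filter_upwards [habs n, Lp.coeFn_abs η] with ω h h'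
      rwa [h']
    exact tendsto_of_le_liminf_of_limsup_le (hlsc η η' hconv)
      (limsup_le_of_le (h := Eventually.of_forall fun n => hA3 _ _ (habs n)))
  · intro hfatou u v hv
    refine le_of_forall_gt_imp_ge_of_dense fun c hc => ?_
    obtain ⟨φ, hφ, hφc⟩ := extraction_of_frequently_atTop (frequently_lt_of_liminf_lt (h := hc))
    obtain ⟨ψ, -, hψ⟩ := (tendstoInMeasure_of_tendsto_Lp
      (hv.comp hφ.tendsto_atTop)).exists_seq_tendsto_ae
    obtain ⟨w, hwv, hw⟩ := exists_monotone_minorant_of_ae_tendsto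
      (v := fun n => v (φ (ψ n))) hψ
    have hu : p u ≤ p |u| := hA3 _ _ <| by
      filter_upwards [Lp.coeFn_abs u] with ω hω
      rw [hω, abs_abs]
    exact hu.trans (le_of_tendsto' (hfatou |u| w hw) fun n =>
      (hA3 _ _ (hwv n)).trans (hφc (ψ n)).le)
end

section
/- Conjugate duality formula for the integrated quantile function: for every u ∈ L¹ and every t ∈ (0,1], ∫₀ᵗ q_u(s) ds = inf_{s ∈ [0,∞)} ( t·s + E[ max(|u| − s, 0) ] ). -/
open MeasureTheory Filter Topology ENNReal

/-- The decreasing rearrangement (quantile function)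
`q_u(t) := inf { τ ∈ ℝ : P(|u| > τ) ≤ t }` of a random variable `u`. -/
noncomputable def qtile {Ω : Type*} [MeasurableSpace Ω] (P : Measure Ω)
    (u : Ω → ℝ) (t : ℝ) : ℝ :=
  sInf {τ : ℝ | (P {ω | τ < |u ω|}).toReal ≤ t}

/-- The decreasing rearrangement is the lower adjoint of the survival function of `|u|`. -/
theorem qtile_le_iff {Ω : Type*} [MeasurableSpace Ω] (P : Measure Ω) [IsProbabilityMeasure P]
    {u : Ω → ℝ} (hu : AEMeasurable u P) {s : ℝ} (hs : s ∈ Set.Ioo (0 : ℝ) 1) (a : ℝ) :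
    qtile P u s ≤ a ↔ P.real {ω | a < |u ω|} ≤ s := by
  have hv : AEMeasurable (fun ω => |u ω|) P := hu.abs
  have := Measure.isProbabilityMeasure_map (μ := P) hv
  set F := ProbabilityTheory.cdf (P.map fun ω => |u ω|)
  have hF (τ : ℝ) : P.real {ω | τ < |u ω|} = 1 - F τ := by
    have h := probReal_compl_eq_one_sub (μ := P.map fun ω => |u ω|) (measurableSet_Iic (a := τ))
    rw [Set.compl_Iic, map_measureReal_apply_of_aemeasurable hv measurableSet_Ioi] at h
    rw [ProbabilityTheory.cdf_eq_real]
    exact h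
  have hq : qtile P u s = sInf {τ : ℝ | 1 - s ≤ F τ} := by
    unfold qtile
    congr 1
    ext τ
    have := hF τ
    simp only [Measure.real] at this
    simp only [Set.mem_ofPred_eq, this]
    constructor <;> intro h <;> linarith
  have hbdd : BddBelow {τ : ℝ | 1 - s ≤ F τ} := by
    refine ⟨0, fun τ hτ => ?_⟩
    by_contra! h
    have h1 : {ω | τ < |u ω|} = Set.univ :=
      Set.eq_univ_of_forall fun ω => h.trans_le (abs_nonneg _)
    have h2 := hF τ
    rw [h1, probReal_univ] at h2
    have : 1 - s ≤ F τ := hτ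
    linarith [hs.2]
  have hne : {τ : ℝ | 1 - s ≤ F τ}.Nonempty := by
    obtain ⟨τ, hτ⟩ := ((ProbabilityTheory.tendsto_cdf_atTop (P.map fun ω => |u ω|)).eventually
      (eventually_ge_nhds (show 1 - s < 1 by linarith [hs.1]))).exists
    exact ⟨τ, hτ⟩
  rw [hF, hq]
  constructor
  · intro h
    have hmem (b : ℝ) (hb : a < b) : 1 - s ≤ F b := by
      obtain ⟨τ, hτ, hτb⟩ := exists_lt_of_csInf_lt hne (h.trans_lt hb)
      exact le_trans hτ (F.mono hτb.le)
    have hlim : Tendsto F (𝓝[>] a) (𝓝 (F a)) :=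
      (F.right_continuous a).mono_left (nhdsWithin_mono _ Set.Ioi_subset_Ici_self)
    have := ge_of_tendsto hlim (eventually_nhdsWithin_of_forall hmem)
    linarith
  · intro h
    exact csInf_le hbdd (by simp only [Set.mem_ofPred_eq]; linarith)

theorem antitoneOn_qtile {Ω : Type*} [MeasurableSpace Ω] (P : Measure Ω)
    [IsProbabilityMeasure P] {u : Ω → ℝ} (hu : AEMeasurable u P) :
    AntitoneOn (qtile P u) (Set.Ioo 0 1) := fun _ ha _ hb hab =>
  (qtile_le_iff P hu hb _).2 (((qtile_le_iff P hu ha _).1 le_rfl).trans hab)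

theorem qtile_nonneg {Ω : Type*} [MeasurableSpace Ω] (P : Measure Ω)
    [IsProbabilityMeasure P] {u : Ω → ℝ} (hu : AEMeasurable u P) {s : ℝ}
    (hs : s ∈ Set.Ioo (0 : ℝ) 1) : 0 ≤ qtile P u s := by
  by_contra! h
  have h1 : {ω | qtile P u s < |u ω|} = Set.univ :=
    Set.eq_univ_of_forall fun ω => h.trans_le (abs_nonneg _)
  have h2 := (qtile_le_iff P hu hs _).1 le_rfl
  rw [h1, probReal_univ] at h2
  linarith [hs.2]

/-- The decreasing rearrangement on `(0, 1)` is equidistributed with `|u|`. -/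
theorem identDistrib_qtile {Ω : Type*} [MeasurableSpace Ω] (P : Measure Ω)
    [IsProbabilityMeasure P] {u : Ω → ℝ} (hu : AEMeasurable u P) :
    ProbabilityTheory.IdentDistrib (qtile P u) (fun ω => |u ω|)
      (volume.restrict (Set.Ioo (0 : ℝ) 1)) P := by
  have hq : AEMeasurable (qtile P u) (volume.restrict (Set.Ioo (0 : ℝ) 1)) :=
    aemeasurable_restrict_of_antitoneOn measurableSet_Ioo (antitoneOn_qtile P hu)
  have hv : AEMeasurable (fun ω => |u ω|) P := hu.abs
  refine ⟨hq, hv, ?_⟩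
  have := Measure.isProbabilityMeasure_map (μ := P) hv
  refine Measure.ext_of_Iic _ _ fun a => ?_
  rw [Measure.map_apply_of_aemeasurable hq measurableSet_Iic,
    Measure.restrict_apply' measurableSet_Ioo]
  have hset : qtile P u ⁻¹' Set.Iic a ∩ Set.Ioo 0 1
      = Set.Ici (P.real {ω | a < |u ω|}) ∩ Set.Ioo 0 1 := by
    ext s
    simp only [Set.mem_inter_iff, Set.mem_preimage, Set.mem_Iic, Set.mem_Ici]
    exact and_congr_left fun hs => qtile_le_iff P hu hs a
  have hcompl := probReal_compl_eq_one_sub (μ := P.map fun ω => |u ω|)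
    (measurableSet_Ioi (a := a))
  rw [Set.compl_Ioi, map_measureReal_apply_of_aemeasurable hv measurableSet_Ioi] at hcompl
  have hae : (Set.Ici (P.real {ω | a < |u ω|}) ∩ Set.Ioo 0 1 : Set ℝ)
      =ᵐ[volume] Set.Ico (P.real {ω | a < |u ω|}) 1 := by
    have h0 : ∀ᵐ x : ℝ, x ≠ 0 := by simp [ae_iff]
    filter_upwards [h0] with x hx
    refine propext ⟨fun h => ⟨h.1, h.2.2⟩, fun h => ⟨h.1, ?_, h.2⟩⟩
    exact lt_of_le_of_ne (measureReal_nonneg.trans h.1) hx.symm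
  rw [hset, measure_congr hae, Real.volume_Ico, ← ofReal_measureReal, hcompl]
  rfl

/-- Conjugate duality formula for the integrated quantile function: for every
`u ∈ L¹` and `t ∈ (0,1]`,
`∫₀ᵗ q_u(s) ds = inf_{s ≥ 0} ( t·s + E[(|u| − s)⁺] )`. -/
theorem integral_qtile_eq_inf
    {Ω : Type*} [MeasurableSpace Ω] (P : Measure Ω) [IsProbabilityMeasure P]
    (u : Lp ℝ 1 P) (t : ℝ) (ht0 : 0 < t) (ht1 : t ≤ 1) :
    (∫ s in (0:ℝ)..t, qtile P (u : Ω → ℝ) s)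
      = sInf {x : ℝ | ∃ s : ℝ, 0 ≤ s ∧
          x = t * s + ∫ ω, max (|u ω| - s) 0 ∂P} := by
  have hui : Integrable u P := L1.integrable_coeFn u
  have hu : AEMeasurable u P := hui.aemeasurable
  have hid := identDistrib_qtile P hu
  set q := qtile P u
  have hqi : IntegrableOn q (Set.Ioo 0 1) := hid.integrable_iff.2 hui.abs
  have hexp (s : ℝ) : ∫ ω, max (|u ω| - s) 0 ∂P = ∫ x in Set.Ioo (0 : ℝ) 1, max (q x - s) 0 :=
    (hid.comp (u := fun y : ℝ => max (y - s) 0) (by fun_prop)).integral_eq.symm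
  have hsub : Set.Ioo 0 t ⊆ Set.Ioo (0 : ℝ) 1 := Set.Ioo_subset_Ioo_right ht1
  have hposi (s : ℝ) : IntegrableOn (fun x => max (q x - s) 0) (Set.Ioo 0 1) :=
    Integrable.pos_part (hqi.sub (integrable_const s))
  have hconst (s : ℝ) : ∫ _ in Set.Ioo 0 t, s = t * s := by
    simp [ht0.le]
  have hadd (s : ℝ) : ∫ x in Set.Ioo 0 t, (s + max (q x - s) 0)
      = t * s + ∫ x in Set.Ioo 0 t, max (q x - s) 0 := by
    rw [integral_add (integrable_const s) ((hposi s).mono_set hsub), hconst]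
  rw [intervalIntegral.integral_of_le ht0.le, integral_Ioc_eq_integral_Ioo]
  refine (IsLeast.csInf_eq ⟨?_, ?_⟩).symm
  · obtain ⟨s, hs0, hle, hge⟩ : ∃ s : ℝ, 0 ≤ s ∧ (∀ x ∈ Set.Ioo 0 t, s ≤ q x) ∧
        ∀ x ∈ Set.Ioo 0 1 \ Set.Ioo 0 t, q x ≤ s := by
      rcases ht1.lt_or_eq with h | rfl
      · have ht : t ∈ Set.Ioo (0 : ℝ) 1 := ⟨ht0, h⟩
        refine ⟨q t, qtile_nonneg P hu ht,
          fun x hx => antitoneOn_qtile P hu (hsub hx) ht hx.2.le, fun x hx => ?_⟩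
        exact antitoneOn_qtile P hu ht hx.1 (not_lt.1 fun hlt => hx.2 ⟨hx.1.1, hlt⟩)
      · exact ⟨0, le_rfl, fun x hx => qtile_nonneg P hu hx, fun x hx => absurd hx.1 hx.2⟩
    refine ⟨s, hs0, ?_⟩
    rw [hexp, setIntegral_eq_of_subset_of_forall_sdiff_eq_zero measurableSet_Ioo hsub
      (fun x hx => max_eq_right (sub_nonpos.2 (hge x hx))), ← hadd]
    refine setIntegral_congr_fun measurableSet_Ioo fun x hx => ?_
    simp only [max_eq_left (sub_nonneg.2 (hle x hx))]
    ring
  · rintro _ ⟨s, -, rfl⟩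
    calc ∫ x in Set.Ioo 0 t, q x ≤ ∫ x in Set.Ioo 0 t, (s + max (q x - s) 0) := by
          refine integral_mono (hqi.mono_set hsub)
            ((integrable_const s).add ((hposi s).mono_set hsub)) fun x => ?_
          have := le_max_left (q x - s) 0
          simp only
          linarith
      _ = t * s + ∫ x in Set.Ioo 0 t, max (q x - s) 0 := hadd s
      _ ≤ t * s + ∫ ω, max (|u ω| - s) 0 ∂P := by
          rw [hexp]
          refine add_le_add_right ?_ _
          exact setIntegral_mono_set (hposi s) (ae_of_all _ fun x => le_max_right _ _)
            hsub.eventuallyLE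
end
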